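/- Let M be a sharp toric monoid, p ⊂ M a prime ideal of height 1, and F = M ∖ p the corresponding facet. Then the following conditions are equivalent: (a) F splits off, i.e. there exists a face K of M such that the addition map F × K → M is bijective; (b) the ideal (F⁺) = F⁺ + M generated by F⁺ = F ∖ {0} is prime and height((F⁺)) ≥ rk(M) − 1; (c) (F⁺) is prime and at most one edge of M is not contained in F; (d) (F⁺) equals the union of all prime ideals of M of height 1 that are different from p; (e) p is principal, i.e. p = e + M for some e ∈ M. -/

import Mathlib

open scoped TensorProduct Pointwise

/-- The rank of an abelian group `A`, i.e. `dim_ℚ (A ⊗_ℤ ℚ)`, for a subgroup of an ambient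
abelian group. -/
noncomputable def grpRank {G : Type*} [AddCommGroup G] (A : AddSubgroup G) : ℕ :=
  Module.finrank ℚ (ℚ ⊗[ℤ] A)

variable {Λ : Type*} [AddCommGroup Λ]

/-- The rank of the subgroup generated by a subset `S` of `Λ`. -/
noncomputable def setRank (S : Set Λ) : ℕ :=
  grpRank (AddSubgroup.closure S)

/-- The rank of a submonoid `M` of `Λ`; when `Λ = M^gp` this is `rk M = dim_ℚ(M^gp ⊗ ℚ)`. -/
noncomputable def monRank (M : AddSubmonoid Λ) : ℕ :=
  setRank (M : Set Λ)

/-- A toric monoid, presented as a submonoid `M` of an abelian group `Λ` which plays the role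
of `M^gp`: `M` is finitely generated (hence fine, being cancellative as a submonoid of a
group), `M` generates `Λ` as a group (so that `Λ = M^gp`), `Λ` is torsion free, and `M`
is saturated in `Λ`. -/
def IsToric (M : AddSubmonoid Λ) : Prop :=
  M.FG ∧ AddSubgroup.closure (M : Set Λ) = ⊤ ∧
    (∀ (x : Λ) (n : ℕ), 0 < n → n • x = 0 → x = 0) ∧
    (∀ (x : Λ) (n : ℕ), 0 < n → n • x ∈ M → x ∈ M)

/-- `M` is sharp: `0` is its only unit. -/
def IsSharp (M : AddSubmonoid Λ) : Prop :=
  ∀ x ∈ M, ∀ y ∈ M, x + y = 0 → x = 0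

/-- An ideal of the monoid `M`: a subset `I ⊆ M` with `I + M ⊆ I`. -/
def IsMonIdeal (M : AddSubmonoid Λ) (I : Set Λ) : Prop :=
  I ⊆ (M : Set Λ) ∧ ∀ i ∈ I, ∀ m ∈ M, i + m ∈ I

/-- A prime ideal of the monoid `M`: an ideal `p ≠ M` such that `x + y ∈ p` implies `x ∈ p` or
`y ∈ p`.  The empty set counts as a prime ideal. -/
def IsPrimeMonIdeal (M : AddSubmonoid Λ) (p : Set Λ) : Prop :=
  IsMonIdeal M p ∧ p ≠ (M : Set Λ) ∧ ∀ x ∈ M, ∀ y ∈ M, x + y ∈ p → x ∈ p ∨ y ∈ p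

/-- The height of a prime ideal `p` of `M`: the supremum (in `ℕ∞`) of the lengths `n` of chains
`p₀ ⊊ p₁ ⊊ ⋯ ⊊ pₙ = p` of prime ideals of `M`. -/
noncomputable def primeHeight (M : AddSubmonoid Λ) (p : Set Λ) : ℕ∞ :=
  sSup {n : ℕ∞ | ∃ m : ℕ, n = (m : ℕ∞) ∧ ∃ c : Fin (m + 1) → Set Λ,
    (∀ i, IsPrimeMonIdeal M (c i)) ∧ StrictMono c ∧ c (Fin.last m) = p}

/-- A face of the monoid `M`: a submonoid `F ⊆ M` such that `x + y ∈ F` implies `x ∈ F` and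
`y ∈ F` for `x, y ∈ M`. -/
def IsFace (M : AddSubmonoid Λ) (F : Set Λ) : Prop :=
  F ⊆ (M : Set Λ) ∧ 0 ∈ F ∧ (∀ x ∈ F, ∀ y ∈ F, x + y ∈ F) ∧
    ∀ x ∈ M, ∀ y ∈ M, x + y ∈ F → x ∈ F ∧ y ∈ F

/-- A facet of `M`: a face of rank `rk(M) - 1`. -/
def IsFacet (M : AddSubmonoid Λ) (F : Set Λ) : Prop :=
  IsFace M F ∧ (setRank F : ℤ) = (monRank M : ℤ) - 1

/-- An edge of `M`: a face of rank `1`. -/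
def IsEdge (M : AddSubmonoid Λ) (E : Set Λ) : Prop :=
  IsFace M E ∧ setRank E = 1

/-- The face `N` splits off from `M`: there is a face `K` such that the addition map
`N × K → M` is bijective. -/
def SplitsOff (M : AddSubmonoid Λ) (N : Set Λ) : Prop :=
  ∃ K : Set Λ, IsFace M K ∧
    (∀ m ∈ M, ∃ a ∈ N, ∃ b ∈ K, m = a + b) ∧
    (∀ a ∈ N, ∀ b ∈ K, ∀ a' ∈ N, ∀ b' ∈ K, a + b = a' + b' → a = a' ∧ b = b')


/-! ### Ranks -/

lemma setRank_eq_finrank_span (S : Set Λ) :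
    setRank S =
      Module.finrank ℚ (Submodule.span ℚ (TensorProduct.mk ℤ ℚ Λ 1 '' S)) := by
  rw [← Submodule.baseChange_span, setRank, ← Submodule.span_int_eq_addSubgroupClosure]
  have h : Function.Injective ((Submodule.span ℤ S).subtype.baseChange ℚ) :=
    Module.Flat.lTensor_preserves_injective_linearMap _ (Submodule.span ℤ S).subtype_injective
  exact (LinearMap.finrank_range_of_inj h).symm

lemma setRank_eq_finrank_int [Module.Free ℤ Λ] [Module.Finite ℤ Λ] (S : Set Λ) :
    setRank S = Module.finrank ℤ (AddSubgroup.closure S) := by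
  have : Module.Free ℤ (AddSubgroup.closure S) :=
    inferInstanceAs (Module.Free ℤ (AddSubgroup.toIntSubmodule (AddSubgroup.closure S)))
  exact Module.finrank_baseChange

lemma setRank_mono [Module.Finite ℤ Λ] {S T : Set Λ} (h : S ⊆ T) : setRank S ≤ setRank T := by
  rw [setRank_eq_finrank_span, setRank_eq_finrank_span]
  exact Submodule.finrank_mono (Submodule.span_mono (Set.image_mono h))

lemma setRank_singleton_zero : setRank ({0} : Set Λ) = 0 := by
  rw [setRank_eq_finrank_span, Set.image_singleton, map_zero, Submodule.span_zero_singleton,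
    finrank_bot]

lemma exists_nsmul_mem_closure_of_mem_span [Module.Free ℤ Λ] {S : Set Λ} {x : Λ}
    (hx : TensorProduct.mk ℤ ℚ Λ 1 x ∈ Submodule.span ℚ (TensorProduct.mk ℤ ℚ Λ 1 '' S)) :
    ∃ n : ℕ, 0 < n ∧ n • x ∈ AddSubgroup.closure S := by
  have key : ∀ v ∈ Submodule.span ℚ (TensorProduct.mk ℤ ℚ Λ 1 '' S),
      ∃ n : ℕ, 0 < n ∧ ∃ w ∈ AddSubgroup.closure S, n • v = TensorProduct.mk ℤ ℚ Λ 1 w := by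
    intro v hv
    induction hv using Submodule.span_induction with
    | mem v hv =>
      obtain ⟨w, hw, rfl⟩ := hv
      exact ⟨1, one_pos, w, AddSubgroup.subset_closure hw, one_smul _ _⟩
    | zero => exact ⟨1, one_pos, 0, zero_mem _, by simp⟩
    | add v v' _ _ h h' =>
      obtain ⟨n, hn, w, hw, e⟩ := h
      obtain ⟨n', hn', w', hw', e'⟩ := h'
      refine ⟨n * n', Nat.mul_pos hn hn', n' • w + n • w',
        add_mem (nsmul_mem hw _) (nsmul_mem hw' _), ?_⟩
      rw [map_add, map_nsmul, map_nsmul, ← e, ← e', smul_add, smul_smul, smul_smul, mul_comm n']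
    | smul q v _ h =>
      obtain ⟨n, hn, w, hw, e⟩ := h
      refine ⟨q.den * n, Nat.mul_pos q.den_pos hn, q.num • w, zsmul_mem hw _, ?_⟩
      rw [map_zsmul, ← e, ← Nat.cast_smul_eq_nsmul ℚ, ← Int.cast_smul_eq_zsmul ℚ,
        ← Nat.cast_smul_eq_nsmul ℚ, smul_smul, smul_smul]
      congr 1
      push_cast
      rw [mul_right_comm, Rat.den_mul_eq_num]
  obtain ⟨n, hn, w, hw, e⟩ := key _ hx
  refine ⟨n, hn, ?_⟩
  rw [← map_nsmul] at e
  have hinj : Function.Injective (TensorProduct.mk ℤ ℚ Λ 1) := by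
    have h := (Module.Flat.rTensor_preserves_injective_linearMap (M := Λ) (Algebra.linearMap ℤ ℚ)
      (algebraMap ℤ ℚ).injective_int).comp (TensorProduct.lid ℤ Λ).symm.injective
    convert h using 1
    ext x
    simp
  rwa [hinj e]

lemma setRank_le_add_one [Module.Finite ℤ Λ] {S T : Set Λ} {x : Λ}
    (h : ∀ y ∈ T, ∃ b : ℕ, 0 < b ∧ ∃ a : ℕ, ∃ g ∈ S, ∃ z ∈ S, b • y + g = a • x + z) :
    setRank T ≤ setRank S + 1 := by
  rw [setRank_eq_finrank_span, setRank_eq_finrank_span]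
  set j := TensorProduct.mk ℤ ℚ Λ 1
  have hle : Submodule.span ℚ (j '' T) ≤ Submodule.span ℚ (j '' S) ⊔ Submodule.span ℚ {j x} := by
    rw [Submodule.span_le]
    rintro _ ⟨y, hy, rfl⟩
    obtain ⟨b, hb, a, g, hg, z, hz, e⟩ := h y hy
    have e' : b • j y + j g = a • j x + j z := by
      rw [← map_nsmul, ← map_nsmul, ← map_add, ← map_add, e]
    have hm : (b : ℚ) • j y ∈ Submodule.span ℚ (j '' S) ⊔ Submodule.span ℚ {j x} := by
      rw [Nat.cast_smul_eq_nsmul, eq_sub_of_add_eq e']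
      have hS : ∀ s ∈ S, j s ∈ Submodule.span ℚ (j '' S) ⊔ Submodule.span ℚ {j x} := fun s hs =>
        Submodule.mem_sup_left (Submodule.subset_span (Set.mem_image_of_mem j hs))
      exact sub_mem (add_mem (nsmul_mem
        (Submodule.mem_sup_right (Submodule.mem_span_singleton_self _)) _) (hS z hz)) (hS g hg)
    exact (Submodule.smul_mem_iff _ (by positivity)).1 hm
  calc _ ≤ _ := Submodule.finrank_mono hle
    _ ≤ _ := Submodule.finrank_add_le_finrank_add_finrank _ _
    _ ≤ _ := Nat.add_le_add_left ((finrank_span_le_card _).trans (by simp)) _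

/-! ### Faces -/

namespace IsFace

variable {M : AddSubmonoid Λ} {F G H : Set Λ}

lemma add_mem (hF : IsFace M F) {x y : Λ} (hx : x ∈ F) (hy : y ∈ F) : x + y ∈ F :=
  hF.2.2.1 x hx y hy

lemma of_add (hF : IsFace M F) {x y : Λ} (hx : x ∈ M) (hy : y ∈ M) (h : x + y ∈ F) :
    x ∈ F ∧ y ∈ F :=
  hF.2.2.2 x hx y hy h

/-- A face, as a submonoid. -/
def submonoid (hF : IsFace M F) : AddSubmonoid Λ where
  carrier := F
  zero_mem' := hF.2.1
  add_mem' := hF.add_mem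

lemma nsmul_mem (hF : IsFace M F) {x : Λ} (hx : x ∈ F) (n : ℕ) : n • x ∈ F :=
  AddSubmonoid.nsmul_mem hF.submonoid hx n

lemma of_nsmul_mem (hF : IsFace M F) {x : Λ} (hx : x ∈ M) {n : ℕ} (hn : 0 < n)
    (h : n • x ∈ F) : x ∈ F := by
  obtain ⟨m, rfl⟩ := Nat.exists_eq_succ_of_ne_zero hn.ne'
  rw [Nat.succ_eq_add_one, add_nsmul, one_nsmul] at h
  exact (hF.of_add (AddSubmonoid.nsmul_mem M hx m) hx h).2

lemma inter (hF : IsFace M F) (hG : IsFace M G) : IsFace M (F ∩ G) :=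
  ⟨fun _ hx => hF.1 hx.1, ⟨hF.2.1, hG.2.1⟩,
    fun _ hx _ hy => ⟨hF.add_mem hx.1 hy.1, hG.add_mem hx.2 hy.2⟩,
    fun _ hx _ hy h => ⟨⟨(hF.of_add hx hy h.1).1, (hG.of_add hx hy h.2).1⟩,
      (hF.of_add hx hy h.1).2, (hG.of_add hx hy h.2).2⟩⟩

lemma self (M : AddSubmonoid Λ) : IsFace M (M : Set Λ) :=
  ⟨subset_rfl, M.zero_mem, fun _ hx _ hy => M.add_mem hx hy, fun _ hx _ hy _ => ⟨hx, hy⟩⟩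

lemma zero (hsharp : IsSharp M) : IsFace M {0} := by
  refine ⟨by simp, rfl, by simp, fun x hx y hy h => ?_⟩
  have h0 := hsharp x hx y hy h
  subst h0
  exact ⟨rfl, by simpa using h⟩

lemma submonoid_fg (hF : IsFace M F) (hM : M.FG) : hF.submonoid.FG := by
  obtain ⟨S, hS⟩ := hM
  have hSM : ∀ s ∈ S, s ∈ M := fun s hs => hS ▸ AddSubmonoid.subset_closure hs
  rw [AddSubmonoid.fg_iff]
  refine ⟨S ∩ F, le_antisymm (AddSubmonoid.closure_le.2 Set.inter_subset_right) ?_,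
    S.finite_toSet.inter_of_left F⟩
  intro x hx
  have hxM : x ∈ AddSubmonoid.closure (S : Set Λ) := hS ▸ hF.1 hx
  replace hx : x ∈ F := hx
  induction hxM using AddSubmonoid.closure_induction with
  | mem x h => exact AddSubmonoid.subset_closure ⟨h, hx⟩
  | zero => exact zero_mem _
  | add x y hx' hy' h h' =>
    have := hF.of_add (hS ▸ hx') (hS ▸ hy') hx
    exact AddSubmonoid.add_mem _ (h this.1) (h' this.2)

/-- The face generated by a face `G` and an element `z`. -/
lemma join (hG : IsFace M G) (z : Λ) :
    IsFace M {w | w ∈ M ∧ ∃ n : ℕ, ∃ g ∈ G, ∃ u ∈ M, n • z + g = w + u} := by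
  refine ⟨fun w hw => hw.1, ⟨zero_mem _, 0, 0, hG.2.1, 0, zero_mem _, by simp⟩, ?_, ?_⟩
  · rintro w ⟨hw, n, g, hg, u, hu, e⟩ w' ⟨hw', n', g', hg', u', hu', e'⟩
    refine ⟨M.add_mem hw hw', n + n', g + g', hG.add_mem hg hg', u + u', M.add_mem hu hu', ?_⟩
    rw [add_nsmul, add_add_add_comm, e, e', add_add_add_comm]
  · rintro x hx y hy ⟨_, n, g, hg, u, hu, e⟩
    exact ⟨⟨hx, n, g, hg, y + u, M.add_mem hy hu, by rw [e, add_assoc]⟩,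
      hy, n, g, hg, x + u, M.add_mem hx hu, by rw [e]; abel⟩

end IsFace

lemma AddSubmonoid.FG.comap_nat_prod {N : AddSubmonoid Λ} (hN : N.FG) (f : ℕ × ℕ →+ Λ) :
    (N.comap f).FG := by
  classical
  obtain ⟨S, hS⟩ := hN
  let φ : (S → ℕ) →+ Λ :=
    { toFun := fun c => ∑ s, c s • (s : Λ)
      map_zero' := by simp
      map_add' := fun c d => by simp [add_nsmul, Finset.sum_add_distrib] }
  have hφ : ∀ x, x ∈ N ↔ ∃ c, φ c = x := by
    intro x
    constructor
    · intro hx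
      rw [← hS] at hx
      induction hx using AddSubmonoid.closure_induction with
      | mem x h =>
        refine ⟨Pi.single ⟨x, h⟩ 1, ?_⟩
        change ∑ s, _ = _
        rw [Finset.sum_eq_single ⟨x, h⟩] <;> simp +contextual
      | zero => exact ⟨0, map_zero φ⟩
      | add x y _ _ h h' =>
        obtain ⟨c, rfl⟩ := h
        obtain ⟨d, rfl⟩ := h'
        exact ⟨c + d, map_add φ c d⟩
    · rintro ⟨c, rfl⟩
      exact AddSubmonoid.sum_mem N fun s _ =>
        AddSubmonoid.nsmul_mem N (hS ▸ AddSubmonoid.subset_closure s.2) _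
  have hfg := AddSubmonoid.fg_eqLocusM (f.comp (AddMonoidHom.fst (ℕ × ℕ) (S → ℕ)))
    (φ.comp (AddMonoidHom.snd (ℕ × ℕ) (S → ℕ)))
  convert hfg.map (AddMonoidHom.fst (ℕ × ℕ) (S → ℕ)) using 1
  ext t
  simp only [AddSubmonoid.mem_comap, hφ, AddSubmonoid.mem_map]
  constructor
  · rintro ⟨c, hc⟩
    exact ⟨(t, c), hc.symm, rfl⟩
  · rintro ⟨⟨t', c⟩, h, rfl⟩
    exact ⟨c, Eq.symm h⟩

lemma AddSubmonoid.FG.exists_max_ratio {P : AddSubmonoid (ℕ × ℕ)} (hP : P.FG)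
    (h1 : (0, 1) ∈ P) (h0 : ∀ a, (a, 0) ∈ P → a = 0) :
    ∃ t ∈ P, 0 < t.2 ∧ ∀ s ∈ P, s.1 * t.2 ≤ t.1 * s.2 := by
  classical
  obtain ⟨S, hS⟩ := hP
  have hSP : ∀ s ∈ S, s ∈ P := fun s hs => hS ▸ AddSubmonoid.subset_closure hs
  have hne : (S.filter fun s => 0 < s.2).Nonempty := by
    by_contra! hemp
    have : ∀ t ∈ P, t.2 = 0 := by
      intro t ht
      rw [← hS] at ht
      induction ht using AddSubmonoid.closure_induction with
      | mem x h =>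
        by_contra hx
        have : x ∈ S.filter fun s => 0 < s.2 := by simpa using ⟨h, Nat.pos_of_ne_zero hx⟩
        simp [hemp] at this
      | zero => rfl
      | add x y _ _ h h' => simp [h, h']
    exact one_ne_zero (this _ h1)
  obtain ⟨t, ht, hmax⟩ := Finset.exists_max_image _ (fun s : ℕ × ℕ => (s.1 : ℚ) / s.2) hne
  rw [Finset.mem_filter] at ht
  refine ⟨t, hSP t ht.1, ht.2, fun s hs => ?_⟩
  rw [← hS] at hs
  induction hs using AddSubmonoid.closure_induction with
  | mem s h =>
    rcases Nat.eq_zero_or_pos s.2 with h2 | h2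
    · have : s.1 = 0 := h0 _ (by rw [← h2]; exact hSP s h)
      simp [this]
    · have := hmax s (Finset.mem_filter.2 ⟨h, h2⟩)
      rw [div_le_div_iff₀ (by exact_mod_cast h2) (by exact_mod_cast ht.2)] at this
      exact_mod_cast this
  | zero => simp
  | add x y _ _ h h' =>
    simp only [Prod.fst_add, Prod.snd_add, add_mul, mul_add]
    exact Nat.add_le_add h h'

/-- Moving from `y` in the direction `-x` modulo the face `G` until leaving `M`, one ends in a
point `z` such that the face generated by `G` and `z` does not contain `x`. -/
lemma IsFace.exists_boundary {M : AddSubmonoid Λ} (hM : M.FG) {G : Set Λ} (hG : IsFace M G)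
    {x y : Λ} (hx : x ∈ M) (hxG : x ∉ G) (hy : y ∈ M) :
    ∃ b : ℕ, 0 < b ∧ ∃ a : ℕ, ∃ g ∈ G, ∃ z ∈ M, b • y + g = a • x + z ∧
      x ∉ {w | w ∈ M ∧ ∃ n : ℕ, ∃ g ∈ G, ∃ u ∈ M, n • z + g = w + u} := by
  let f : ℕ × ℕ →+ Λ :=
    { toFun := fun t => t.2 • y - t.1 • x
      map_zero' := by simp
      map_add' := fun s t => by simp only [Prod.fst_add, Prod.snd_add, add_nsmul]; abel }
  let N : AddSubmonoid Λ := M ⊔ hG.submonoid.map (-AddMonoidHom.id Λ)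
  have hN : N.FG := hM.sup ((hG.submonoid_fg hM).map _)
  have hmem : ∀ t : ℕ × ℕ, t ∈ N.comap f ↔ ∃ g ∈ G, ∃ z ∈ M, t.2 • y + g = t.1 • x + z := by
    intro t
    rw [AddSubmonoid.mem_comap, AddSubmonoid.mem_sup]
    constructor
    · rintro ⟨z, hz, _, ⟨g, hg, rfl⟩, e⟩
      refine ⟨g, hg, z, hz, ?_⟩
      have e' : z + -g = t.2 • y - t.1 • x := e
      rw [eq_sub_iff_add_eq] at e'
      rw [← e']
      abel
    · rintro ⟨g, hg, z, hz, e⟩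
      refine ⟨z, hz, -g, ⟨g, hg, rfl⟩, ?_⟩
      change z + -g = t.2 • y - t.1 • x
      rw [eq_sub_of_add_eq e]
      abel
  obtain ⟨⟨a, b⟩, ht, hb, hmax⟩ := (hN.comap_nat_prod f).exists_max_ratio
    ((hmem _).2 ⟨0, hG.2.1, y, hy, by simp⟩) (by
      intro a ha
      obtain ⟨g, hg, z, hz, e⟩ := (hmem _).1 ha
      by_contra ha0
      rw [zero_nsmul, zero_add] at e
      exact hxG (hG.of_nsmul_mem hx (Nat.pos_of_ne_zero ha0)
        (hG.of_add (AddSubmonoid.nsmul_mem M hx a) hz (e ▸ hg)).1))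
  obtain ⟨g, hg, z, hz, e⟩ := (hmem _).1 ht
  refine ⟨b, hb, a, g, hg, z, hz, e, ?_⟩
  rintro ⟨-, n, g', hg', u, hu, e'⟩
  have h := hmax (n * a + 1, n * b) ((hmem _).2
    ⟨n • g + g', hG.add_mem (hG.nsmul_mem hg n) hg', u, hu, ?_⟩)
  · simp only at h hb
    nlinarith
  · simp only at e ⊢
    rw [← add_assoc, mul_nsmul', ← nsmul_add, e, nsmul_add, add_assoc, e', add_nsmul, one_nsmul,
      mul_nsmul', add_assoc]

/-! ### Ranks of faces -/

namespace IsFace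

variable {M : AddSubmonoid Λ} {E F G H : Set Λ}

lemma exists_add_eq_of_mem_closure (hF : IsFace M F) {x : Λ} (hx : x ∈ AddSubgroup.closure F) :
    ∃ g ∈ F, ∃ z ∈ F, x + g = z := by
  induction hx using AddSubgroup.closure_induction with
  | mem x h => exact ⟨0, hF.2.1, x, h, add_zero x⟩
  | zero => exact ⟨0, hF.2.1, 0, hF.2.1, add_zero 0⟩
  | add x y _ _ h h' =>
    obtain ⟨g, hg, z, hz, rfl⟩ := h
    obtain ⟨g', hg', z', hz', rfl⟩ := h'
    exact ⟨g + g', hF.add_mem hg hg', _, hF.add_mem hz hz', by abel⟩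
  | neg x _ h =>
    obtain ⟨g, hg, z, hz, rfl⟩ := h
    exact ⟨_, hz, g, hg, by abel⟩

lemma exists_nsmul_add_eq (hM : M.FG) (hG : IsFace M G) (hH : IsFace M H) (hGH : G ⊆ H) {x : Λ}
    (hx : x ∈ H) (hxG : x ∉ G)
    (hmax : ∀ G', IsFace M G' → G ⊆ G' → G' ⊆ H → x ∉ G' → G' = G) {y : Λ} (hy : y ∈ H) :
    ∃ b : ℕ, 0 < b ∧ ∃ a : ℕ, ∃ g ∈ G, ∃ z ∈ G, b • y + g = a • x + z := by
  obtain ⟨b, hb, a, g, hg, z, hz, e, hxz⟩ := hG.exists_boundary hM (hH.1 hx) hxG (hH.1 hy)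
  have hzH : z ∈ H := (hH.of_add (AddSubmonoid.nsmul_mem M (hH.1 hx) a) hz
    (e ▸ hH.add_mem (hH.nsmul_mem hy b) (hGH hg))).2
  have hJ := hmax _ (hG.join z)
    (fun w hw => ⟨hG.1 hw, 0, w, hw, 0, zero_mem _, by simp⟩)
    (by
      rintro w ⟨hw, n, g', hg', u, hu, e'⟩
      exact (hH.of_add hw hu (e' ▸ hH.add_mem (hH.nsmul_mem hzH n) (hGH hg'))).1)
    hxz
  refine ⟨b, hb, a, g, hg, z, ?_, e⟩
  rw [← hJ]
  exact ⟨hz, 1, 0, hG.2.1, 0, zero_mem _, by simp⟩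

section Rank

variable [Module.Free ℤ Λ] [Module.Finite ℤ Λ]

lemma eq_of_setRank_le (hF : IsFace M F) (hG : G ⊆ M) (hFG : F ⊆ G)
    (h : setRank G ≤ setRank F) : F = G := by
  refine hFG.antisymm fun x hx => ?_
  rw [setRank_eq_finrank_span, setRank_eq_finrank_span] at h
  have hs := Submodule.eq_of_le_of_finrank_le
    (Submodule.span_mono (R := ℚ) (Set.image_mono (f := TensorProduct.mk ℤ ℚ Λ 1) hFG)) h
  obtain ⟨n, hn, hnx⟩ := exists_nsmul_mem_closure_of_mem_span
    (hs ▸ Submodule.subset_span (Set.mem_image_of_mem _ hx))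
  obtain ⟨g, hg, z, hz, e⟩ := hF.exists_add_eq_of_mem_closure hnx
  exact hF.of_nsmul_mem (hG hx) hn
    (hF.of_add (AddSubmonoid.nsmul_mem M (hG hx) n) (hF.1 hg) (e ▸ hz)).1

lemma setRank_lt (hF : IsFace M F) (hG : G ⊆ M) (hFG : F ⊆ G) (hne : F ≠ G) :
    setRank F < setRank G := by
  by_contra! h
  exact hne (hF.eq_of_setRank_le hG hFG h)

lemma eq_zero_of_setRank_eq_zero (hsharp : IsSharp M) (hF : IsFace M F) (h : setRank F = 0) :
    F = {0} :=
  ((IsFace.zero hsharp).eq_of_setRank_le hF.1 (by simpa using hF.2.1)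
    (by rw [h]; exact Nat.zero_le _)).symm

lemma setRank_eq_add_one (hM : M.FG) (hG : IsFace M G) (hH : IsFace M H) (hGH : G ⊆ H) {x : Λ}
    (hx : x ∈ H) (hxG : x ∉ G)
    (hmax : ∀ G', IsFace M G' → G ⊆ G' → G' ⊆ H → x ∉ G' → G' = G) :
    setRank H = setRank G + 1 :=
  le_antisymm
    (setRank_le_add_one fun _ hy => hG.exists_nsmul_add_eq hM hH hGH hx hxG hmax hy)
    (hG.setRank_lt hH.1 hGH fun h => hxG (h ▸ hx))

/-- Every face `E` of `H` is the intersection of the facets of `H` containing `E`. -/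
lemma exists_facet_not_mem (hM : M.FG) (hE : IsFace M E) (hH : IsFace M H) (hEH : E ⊆ H) {x : Λ}
    (hx : x ∈ H) (hxE : x ∉ E) :
    ∃ G, IsFace M G ∧ E ⊆ G ∧ G ⊆ H ∧ x ∉ G ∧ setRank H = setRank G + 1 := by
  obtain ⟨G, ⟨hG, hEG, hGH, hxG⟩, hmin⟩ :=
    (measure fun G : Set Λ => setRank H - setRank G).wf.has_min
      {G | IsFace M G ∧ E ⊆ G ∧ G ⊆ H ∧ x ∉ G} ⟨E, hE, subset_rfl, hEH, hxE⟩
  refine ⟨G, hG, hEG, hGH, hxG, hG.setRank_eq_add_one hM hH hGH hx hxG ?_⟩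
  intro G' hG' hGG' hG'H hxG'
  by_contra hne
  refine hmin G' ⟨hG', hEG.trans hGG', hG'H, hxG'⟩ ?_
  have h1 := hG.setRank_lt hG'.1 hGG' (Ne.symm hne)
  have h2 := setRank_mono hG'H
  exact Nat.sub_lt_sub_left (h1.trans_le h2) h1

lemma exists_cover (hM : M.FG) (hE : IsFace M E) (hH : IsFace M H) (hEH : E ⊆ H) (hne : E ≠ H) :
    ∃ G, IsFace M G ∧ E ⊆ G ∧ G ⊆ H ∧ setRank G = setRank E + 1 := by
  obtain ⟨G, ⟨hG, hEG, hGH, hEG'⟩, hmin⟩ :=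
    (measure fun G : Set Λ => setRank G).wf.has_min
      {G | IsFace M G ∧ E ⊆ G ∧ G ⊆ H ∧ E ≠ G} ⟨H, hH, hEH, subset_rfl, hne⟩
  obtain ⟨x, hx, hxE⟩ := Set.exists_of_ssubset (hEG.ssubset_of_ne hEG')
  refine ⟨G, hG, hEG, hGH, hE.setRank_eq_add_one hM hG hEG hx hxE ?_⟩
  intro G' hG' hEG'' hG'G hxG'
  by_contra hne'
  exact hmin G' ⟨hG', hEG'', hG'G.trans hGH, Ne.symm hne'⟩
    (hG'.setRank_lt hG.1 hG'G fun h => hxG' (h ▸ hx))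

lemma exists_isEdge (hM : M.FG) (hsharp : IsSharp M) (hH : IsFace M H) (hne : H ≠ {0}) :
    ∃ E, IsEdge M E ∧ E ⊆ H := by
  obtain ⟨G, hG, -, hGH, h⟩ := (IsFace.zero hsharp).exists_cover hM hH
    (by simpa using hH.2.1) hne.symm
  exact ⟨G, ⟨hG, by rw [h, setRank_singleton_zero]⟩, hGH⟩

lemma setRank_le_one_of_edges (hM : M.FG) (hsharp : IsSharp M) (hH : IsFace M H)
    (h : ∀ E E', IsEdge M E → E ⊆ H → IsEdge M E' → E' ⊆ H → E = E') : setRank H ≤ 1 := by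
  by_contra! hr
  obtain ⟨E, hE, hEH⟩ := hH.exists_isEdge hM hsharp
    (by rintro rfl; rw [setRank_singleton_zero] at hr; omega)
  have hE0 : ({0} : Set Λ) ≠ E := by
    intro h0
    have := hE.2
    rw [← h0, setRank_singleton_zero] at this
    omega
  obtain ⟨x, hx, hx0⟩ := Set.exists_of_ssubset
    (Set.ssubset_iff_subset_ne.2 ⟨by simpa using hE.1.2.1, hE0⟩)
  obtain ⟨G, hG, -, hGH, hxG, hGr⟩ := (IsFace.zero hsharp).exists_facet_not_mem hM hH
    (by simpa using hH.2.1) (hEH hx) hx0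
  obtain ⟨E', hE', hE'G⟩ := hG.exists_isEdge hM hsharp
    (by rintro rfl; rw [setRank_singleton_zero] at hGr; omega)
  exact hxG (hE'G (h E E' hE hEH hE' (hE'G.trans hGH) ▸ hx))

/-- A face of rank at most one of a sharp saturated monoid is generated by one element. -/
lemma exists_generator (hsharp : IsSharp M)
    (hsat : ∀ (x : Λ) (n : ℕ), 0 < n → n • x ∈ M → x ∈ M) (hH : IsFace M H)
    (hr : setRank H ≤ 1) : ∃ e ∈ H, ∀ x ∈ H, ∃ n : ℕ, x = n • e := by
  rw [setRank_eq_finrank_int] at hr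
  have : Module.Free ℤ (AddSubgroup.closure H) :=
    inferInstanceAs (Module.Free ℤ (AddSubgroup.toIntSubmodule (AddSubgroup.closure H)))
  have : Module.Finite ℤ (AddSubgroup.closure H) :=
    inferInstanceAs (Module.Finite ℤ (AddSubgroup.toIntSubmodule (AddSubgroup.closure H)))
  obtain ⟨v, hv⟩ := finrank_le_one_iff.1 hr
  have hv' : ∀ x ∈ H, ∃ c : ℤ, x = c • (v : Λ) := by
    intro x hx
    obtain ⟨c, hc⟩ := hv ⟨x, AddSubgroup.subset_closure hx⟩
    exact ⟨c, (congrArg Subtype.val hc).symm⟩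
  by_cases h0 : ∀ x ∈ H, x = 0
  · exact ⟨0, hH.2.1, fun x hx => ⟨0, by rw [h0 x hx, smul_zero]⟩⟩
  push Not at h0
  obtain ⟨x, hx, hx0⟩ := h0
  obtain ⟨c, hc⟩ := hv' x hx
  have hc0 : c ≠ 0 := by
    rintro rfl
    exact hx0 (by rw [hc, zero_smul])
  obtain ⟨e, n, hn, hxe, he⟩ : ∃ (e : Λ) (n : ℕ), 0 < n ∧ x = n • e ∧
      ∀ y ∈ H, ∃ c : ℤ, y = c • e := by
    rcases lt_or_gt_of_ne hc0 with h | h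
    · refine ⟨-v, c.natAbs, by omega, ?_, fun y hy => ?_⟩
      · rw [hc, ← natCast_zsmul, Int.ofNat_natAbs_of_nonpos h.le, smul_neg, neg_smul, neg_neg]
      · obtain ⟨d, hd⟩ := hv' y hy
        exact ⟨-d, by rw [hd, smul_neg, neg_smul, neg_neg]⟩
    · refine ⟨v, c.natAbs, by omega, ?_, hv'⟩
      rw [hc, ← natCast_zsmul, Int.natAbs_of_nonneg h.le]
  have heM : e ∈ M := hsat e n hn (hxe ▸ hH.1 hx)
  refine ⟨e, hH.of_nsmul_mem heM hn (hxe ▸ hx), fun y hy => ?_⟩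
  obtain ⟨d, rfl⟩ := he y hy
  rcases le_or_gt 0 d with hd | hd
  · exact ⟨d.toNat, by rw [← natCast_zsmul, Int.toNat_of_nonneg hd]⟩
  · refine ⟨0, ?_⟩
    rw [zero_nsmul]
    refine hsharp _ (hH.1 hy) ((-d).toNat • e) (AddSubmonoid.nsmul_mem M heM _) ?_
    rw [← natCast_zsmul, Int.toNat_of_nonneg (by omega), neg_smul, add_neg_cancel]

end Rank

end IsFace

/-! ### Primes and heights -/

lemma IsPrimeMonIdeal.isFace {M : AddSubmonoid Λ} {p : Set Λ} (hp : IsPrimeMonIdeal M p) :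
    IsFace M ((M : Set Λ) \ p) := by
  obtain ⟨⟨hpM, hadd⟩, hne, hprime⟩ := hp
  refine ⟨Set.sdiff_subset, ⟨M.zero_mem, fun h => hne (hpM.antisymm fun x hx => ?_)⟩, ?_, ?_⟩
  · simpa using hadd 0 h x hx
  · exact fun x hx y hy => ⟨M.add_mem hx.1 hy.1, fun h => (hprime x hx.1 y hy.1 h).elim hx.2 hy.2⟩
  · exact fun x hx y hy h => ⟨⟨hx, fun h' => h.2 (hadd x h' y hy)⟩,
      hy, fun h' => h.2 (add_comm x y ▸ hadd y h' x hx)⟩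

lemma IsFace.isPrimeMonIdeal {M : AddSubmonoid Λ} {F : Set Λ} (hF : IsFace M F) :
    IsPrimeMonIdeal M ((M : Set Λ) \ F) := by
  refine ⟨⟨Set.sdiff_subset, fun i hi m hm =>
    ⟨M.add_mem hi.1 hm, fun h => hi.2 (hF.of_add hi.1 hm h).1⟩⟩, fun h => ?_, ?_⟩
  · exact (h.symm ▸ M.zero_mem : (0 : Λ) ∈ (M : Set Λ) \ F).2 hF.2.1
  · intro x hx y hy h
    by_contra! hcon
    exact h.2 (hF.add_mem (by simpa [hx] using hcon.1) (by simpa [hy] using hcon.2))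

lemma primeHeight_eq_height {M : AddSubmonoid Λ} {p : Set Λ} (hp : IsPrimeMonIdeal M p) :
    primeHeight M p = Order.height (⟨p, hp⟩ : {q // IsPrimeMonIdeal M q}) := by
  refine le_antisymm (sSup_le ?_) ?_
  · rintro _ ⟨m, rfl, c, hc, hmono, hlast⟩
    let s : LTSeries {q // IsPrimeMonIdeal M q} :=
      LTSeries.mk m (fun i => ⟨c i, hc i⟩) fun _ _ h => hmono h
    have hs : s.last ≤ ⟨p, hp⟩ := hlast.le
    exact Order.length_le_height hs
  · rw [Order.height_eq_iSup_last_eq]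
    refine iSup₂_le fun s hs => le_sSup ⟨s.length, rfl, fun i => (s i).1, fun i => (s i).2,
      fun _ _ h => s.strictMono h, congrArg Subtype.val hs⟩

lemma primeHeight_add_one_le {M : AddSubmonoid Λ} {p q : Set Λ} (hp : IsPrimeMonIdeal M p)
    (hq : IsPrimeMonIdeal M q) (h : p ⊂ q) : primeHeight M p + 1 ≤ primeHeight M q := by
  rw [primeHeight_eq_height hp, primeHeight_eq_height hq]
  exact Order.height_add_one_le h

lemma IsFace.primeHeight_add_setRank [Module.Free ℤ Λ] [Module.Finite ℤ Λ] {M : AddSubmonoid Λ}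
    (hM : M.FG) {F : Set Λ} (hF : IsFace M F) :
    primeHeight M ((M : Set Λ) \ F) + setRank F = monRank M := by
  apply le_antisymm
  · let φ : {q // IsPrimeMonIdeal M q} → ℕ := fun q => monRank M - setRank ((M : Set Λ) \ q.1)
    have hφ : StrictMono φ := by
      intro q q' h
      have h' : q.1 ⊂ q'.1 := h
      have h1 := q'.2.isFace.setRank_lt q.2.isFace.1 (Set.sdiff_subset_sdiff_right h'.subset)
        (fun e => h'.ne (by
          rw [← Set.inter_eq_right.2 q.2.1.1, ← Set.inter_eq_right.2 q'.2.1.1,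
            ← Set.sdiff_sdiff_right_self, ← Set.sdiff_sdiff_right_self, e]))
      exact Nat.sub_lt_sub_left (h1.trans_le (setRank_mono q.2.isFace.1)) h1
    have h := Order.height_le_height_apply_of_strictMono φ hφ ⟨_, hF.isPrimeMonIdeal⟩
    rw [← primeHeight_eq_height, Order.height_nat] at h
    have h2 : φ ⟨_, hF.isPrimeMonIdeal⟩ = monRank M - setRank F := by
      simp only [φ, Set.sdiff_sdiff_cancel_left hF.1]
    rw [h2] at h
    have h3 : setRank F ≤ monRank M := setRank_mono hF.1
    calc _ ≤ ((monRank M - setRank F : ℕ) : ℕ∞) + setRank F := by gcongr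
      _ = _ := by rw [← Nat.cast_add, Nat.sub_add_cancel h3]
  · induction hn : monRank M - setRank F using Nat.strong_induction_on generalizing F with
    | _ n ih =>
      by_cases hne : F = M
      · rw [hne]
        exact le_add_self
      obtain ⟨G, hG, hFG, -, hr⟩ := hF.exists_cover hM (IsFace.self M) hF.1 hne
      have h1 : setRank G ≤ monRank M := setRank_mono hG.1
      have h2 := ih (monRank M - setRank G) (by omega) hG rfl
      have hss : (M : Set Λ) \ G ⊂ (M : Set Λ) \ F := by
        refine (Set.sdiff_subset_sdiff_right hFG).ssubset_of_ne fun e => ?_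
        have : G = F := by
          rw [← Set.sdiff_sdiff_cancel_left hG.1, e, Set.sdiff_sdiff_cancel_left hF.1]
        rw [this] at hr
        omega
      have h3 := primeHeight_add_one_le hG.isPrimeMonIdeal hF.isPrimeMonIdeal hss
      calc _ ≤ _ := h2
        _ = primeHeight M ((M : Set Λ) \ G) + 1 + setRank F := by
          rw [hr, Nat.cast_add, Nat.cast_one, add_assoc, add_comm (1 : ℕ∞)]
        _ ≤ _ := by gcongr

lemma IsFace.primeHeight_eq_one_iff [Module.Free ℤ Λ] [Module.Finite ℤ Λ] {M : AddSubmonoid Λ}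
    (hM : M.FG) {F : Set Λ} (hF : IsFace M F) :
    primeHeight M ((M : Set Λ) \ F) = 1 ↔ monRank M = setRank F + 1 := by
  rw [← (ENat.add_left_injective_of_ne_top (ENat.natCast_ne_top (setRank F))).eq_iff]
  simp only [hF.primeHeight_add_setRank hM, add_comm (1 : ℕ∞)]
  norm_cast

/-! ### Splitting off a facet -/

lemma AddSubmonoid.FG.le_of_irreducible {M N : AddSubmonoid Λ} (hM : M.FG) (hsharp : IsSharp M)
    (h : ∀ s ∈ M, (∀ a ∈ M, ∀ b ∈ M, s = a + b → a = 0 ∨ b = 0) → s ∈ N) : M ≤ N := by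
  have hu : ∀ a : M, IsAddUnit a → a = 0 := by
    rintro a ⟨u, rfl⟩
    exact Subtype.ext (hsharp _ u.val.2 _ u.neg.2 (congrArg Subtype.val u.val_neg))
  have : Subsingleton (AddUnits M) :=
    ⟨fun u v => AddUnits.ext (by rw [hu _ u.isAddUnit, hu _ v.isAddUnit])⟩
  let _ : AddCancelCommMonoid M :=
    { (inferInstance : AddCommMonoid M) with
      add_left_cancel := fun _ _ _ h => Subtype.ext (add_left_cancel (congrArg Subtype.val h)) }
  have : AddMonoid.FG M := (AddMonoid.fg_iff_addSubmonoid_fg M).2 hM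
  intro x hx
  have hx' : (⟨x, hx⟩ : M) ∈ N.comap M.subtype := by
    refine (AddSubmonoid.closure_le (S := N.comap M.subtype)).2 ?_
      ((AddSubmonoid.closure_addIrreducible (M := M)).symm ▸ AddSubmonoid.mem_top _)
    intro s hs
    refine h s s.2 fun a ha b hb e => ?_
    rcases hs.isAddUnit_or_isAddUnit (a := ⟨a, ha⟩) (b := ⟨b, hb⟩) (Subtype.ext e) with h | h
    · exact Or.inl (congrArg Subtype.val (hu _ h))
    · exact Or.inr (congrArg Subtype.val (hu _ h))
  exact hx'

lemma mem_posPart_add {M : AddSubmonoid Λ} {F : Set Λ} {x : Λ} :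
    x ∈ (F \ {0}) + (M : Set Λ) ↔ ∃ f ∈ F, f ≠ 0 ∧ ∃ m ∈ M, f + m = x := by
  simp [Set.mem_add, and_assoc]

namespace IsFace

variable {M : AddSubmonoid Λ} {E F K : Set Λ}

lemma eq_zero_of_not_mem_posPart_add {x : Λ} (hx : x ∈ F)
    (hxK : x ∉ (F \ {0}) + (M : Set Λ)) : x = 0 := by
  by_contra h
  exact hxK (mem_posPart_add.2 ⟨x, hx, h, 0, zero_mem _, add_zero x⟩)

lemma splitsOff_of_generator (hF : IsFace M F) (hK : IsFace M K)
    (h0 : ∀ x ∈ F, x ∈ K → x = 0) {e : Λ} (he : e ∈ K) (hgen : ∀ x ∈ K, ∃ n : ℕ, x = n • e)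
    (hsum : ∀ m ∈ M, ∃ a ∈ F, ∃ b ∈ K, m = a + b) : SplitsOff M F := by
  refine ⟨K, hK, hsum, ?_⟩
  have key : ∀ a ∈ F, ∀ a' ∈ F, ∀ n n' : ℕ, n ≤ n' → a + n • e = a' + n' • e →
      a = a' ∧ n • e = n' • e := by
    intro a ha a' ha' n n' hn h
    obtain ⟨d, rfl⟩ := Nat.exists_eq_add_of_le hn
    rw [add_comm n d, add_nsmul, ← add_assoc, add_left_inj] at h
    have hd : d • e = 0 := h0 _
      (hF.of_add (hF.1 ha') (AddSubmonoid.nsmul_mem M (hK.1 he) d) (h ▸ ha)).2 (hK.nsmul_mem he d)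
    rw [hd, add_zero] at h
    exact ⟨h, by rw [add_comm n d, add_nsmul, hd, zero_add]⟩
  intro a ha b hb a' ha' b' hb' h
  obtain ⟨n, rfl⟩ := hgen b hb
  obtain ⟨n', rfl⟩ := hgen b' hb'
  rcases le_total n n' with hn | hn
  · exact key a ha a' ha' n n' hn h
  · obtain ⟨h1, h2⟩ := key a' ha' a ha n' n hn h.symm
    exact ⟨h1.symm, h2.symm⟩

lemma splitsOff_of_principal (hM : M.FG) (hsharp : IsSharp M) (hF : IsFace M F) {e : Λ}
    (he : e ∈ M) (hp : (M : Set Λ) \ F = {x : Λ | ∃ m ∈ M, x = e + m}) : SplitsOff M F := by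
  have heF : e ∉ F := by
    have : e ∈ (M : Set Λ) \ F := hp ▸ ⟨0, zero_mem _, (add_zero e).symm⟩
    exact this.2
  have he0 : e ≠ 0 := fun h => heF (h ▸ hF.2.1)
  have hnF : ∀ n : ℕ, n • e ∈ F → n = 0 := by
    intro n hn
    by_contra h
    exact heF (hF.of_nsmul_mem he (Nat.pos_of_ne_zero h) hn)
  have hle : M ≤ hF.submonoid ⊔ AddSubmonoid.multiples e := by
    refine hM.le_of_irreducible hsharp fun s hs hirr => ?_
    by_cases hsF : s ∈ F
    · exact AddSubmonoid.mem_sup_left hsF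
    · obtain ⟨m, hm, rfl⟩ : s ∈ {x : Λ | ∃ m ∈ M, x = e + m} := hp ▸ ⟨hs, hsF⟩
      rw [(hirr e he m hm rfl).resolve_left he0, add_zero]
      exact AddSubmonoid.mem_sup_right (AddSubmonoid.mem_multiples e)
  have hsum : ∀ m ∈ M, ∃ f ∈ F, ∃ n : ℕ, m = f + n • e := by
    intro m hm
    obtain ⟨f, hf, _, ⟨n, rfl⟩, h⟩ := AddSubmonoid.mem_sup.1 (hle hm)
    exact ⟨f, hf, n, h.symm⟩
  have hK : IsFace M (AddSubmonoid.multiples e : Set Λ) := by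
    refine ⟨?_, zero_mem _, fun x hx y hy => AddSubmonoid.add_mem _ hx hy, ?_⟩
    · rintro _ ⟨n, rfl⟩
      exact AddSubmonoid.nsmul_mem M he n
    · rintro x hx y hy ⟨n, hn⟩
      obtain ⟨f, hf, a, rfl⟩ := hsum x hx
      obtain ⟨f', hf', b, rfl⟩ := hsum y hy
      have hn' : n • e = f + f' + (a + b) • e := by
        rw [add_nsmul, add_add_add_comm]
        exact hn
      have hff := hF.add_mem hf hf'
      have hz : f + f' = 0 := by
        rcases le_total n (a + b) with h | h
        · obtain ⟨d, hd⟩ := Nat.exists_eq_add_of_le h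
          rw [hd, add_comm n d, add_nsmul, ← add_assoc, right_eq_add] at hn'
          exact hsharp _ (hF.1 hff) _ (AddSubmonoid.nsmul_mem M he d) hn'
        · obtain ⟨d, rfl⟩ := Nat.exists_eq_add_of_le h
          rw [add_comm (a + b) d, add_nsmul, add_left_inj] at hn'
          rw [← hn', hnF d (hn' ▸ hff), zero_nsmul]
      have hf0 := hsharp f (hF.1 hf) f' (hF.1 hf') hz
      subst hf0
      rw [zero_add] at hz
      subst hz
      exact ⟨⟨a, by simp⟩, b, by simp⟩
  refine hF.splitsOff_of_generator hK ?_ (AddSubmonoid.mem_multiples e)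
    (fun x ⟨n, hn⟩ => ⟨n, hn.symm⟩) fun m hm => ?_
  · rintro _ hx ⟨n, rfl⟩
    change n • e = 0
    rw [hnF n hx, zero_nsmul]
  · obtain ⟨f, hf, n, h⟩ := hsum m hm
    exact ⟨f, hf, n • e, ⟨n, rfl⟩, h⟩

variable [Module.Free ℤ Λ] [Module.Finite ℤ Λ]

lemma edge_inter_eq_zero (hsharp : IsSharp M) (hF : IsFace M F) (hE : IsEdge M E)
    (hEF : ¬ E ⊆ F) {x : Λ} (hx : x ∈ E) (hxF : x ∈ F) : x = 0 := by
  have h := (hE.1.inter hF).setRank_lt hE.1.1 Set.inter_subset_left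
    (fun h => hEF (Set.inter_eq_left.1 h))
  rw [hE.2, Nat.lt_one_iff] at h
  have := (hE.1.inter hF).eq_zero_of_setRank_eq_zero hsharp h
  exact (this ▸ ⟨hx, hxF⟩ : x ∈ ({0} : Set Λ))

lemma edge_subset_compl (hsharp : IsSharp M) (hF : IsFace M F) (hE : IsEdge M E)
    (hEF : ¬ E ⊆ F) : E ⊆ (M : Set Λ) \ ((F \ {0}) + (M : Set Λ)) := by
  refine fun x hx => ⟨hE.1.1 hx, fun h => ?_⟩
  obtain ⟨f, hf, hf0, m, hm, rfl⟩ := mem_posPart_add.1 h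
  exact hf0 (hF.edge_inter_eq_zero hsharp hE hEF (hE.1.of_add (hF.1 hf) hm hx).1 hf)

lemma splitsOff_of_edges (hM : M.FG) (hsharp : IsSharp M)
    (hsat : ∀ (x : Λ) (n : ℕ), 0 < n → n • x ∈ M → x ∈ M) (hF : IsFace M F)
    (hI : IsPrimeMonIdeal M ((F \ {0}) + (M : Set Λ)))
    (hedge : ∀ E E' : Set Λ, IsEdge M E → ¬ E ⊆ F → IsEdge M E' → ¬ E' ⊆ F → E = E') :
    SplitsOff M F := by
  have hK := hI.isFace
  have h0 : ∀ x ∈ F, x ∈ (M : Set Λ) \ ((F \ {0}) + (M : Set Λ)) → x = 0 :=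
    fun x hx hxK => eq_zero_of_not_mem_posPart_add hx hxK.2
  have hEF : ∀ E, IsEdge M E → E ⊆ (M : Set Λ) \ ((F \ {0}) + (M : Set Λ)) → ¬ E ⊆ F := by
    intro E hE hEK hEF
    have : E = {0} := Set.eq_singleton_iff_unique_mem.2
      ⟨hE.1.2.1, fun x hx => h0 x (hEF hx) (hEK hx)⟩
    have h1 := hE.2
    rw [this, setRank_singleton_zero] at h1
    omega
  obtain ⟨e, he, hgen⟩ := hK.exists_generator hsharp hsat
    (hK.setRank_le_one_of_edges hM hsharp fun E E' hE hEK hE' hEK' =>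
      hedge E E' hE (hEF E hE hEK) hE' (hEF E' hE' hEK'))
  refine hF.splitsOff_of_generator hK h0 he hgen ?_
  have hle : M ≤ hF.submonoid ⊔ hK.submonoid := by
    refine hM.le_of_irreducible hsharp fun s hs hirr => ?_
    by_cases hsI : s ∈ (F \ {0}) + (M : Set Λ)
    · obtain ⟨f, hf, hf0, m, hm, rfl⟩ := mem_posPart_add.1 hsI
      rw [(hirr f (hF.1 hf) m hm rfl).resolve_left hf0, add_zero]
      exact AddSubmonoid.mem_sup_left hf
    · exact AddSubmonoid.mem_sup_right ⟨hs, hsI⟩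
  intro m hm
  obtain ⟨a, ha, b, hb, h⟩ := AddSubmonoid.mem_sup.1 (hle hm)
  exact ⟨a, ha, b, hb, h.symm⟩

/-- The complement of a facet that splits off is generated by one element. -/
lemma exists_generator_of_splitsOff (hM : M.FG) (hsharp : IsSharp M)
    (hsat : ∀ (x : Λ) (n : ℕ), 0 < n → n • x ∈ M → x ∈ M) (hF : IsFace M F)
    (hr : monRank M = setRank F + 1) (h : SplitsOff M F) :
    ∃ K, IsFace M K ∧ setRank K ≤ 1 ∧ (∀ x ∈ F, x ∈ K → x = 0) ∧
      (∀ m ∈ M, ∃ a ∈ F, ∃ b ∈ K, m = a + b) ∧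
      ∃ e ∈ K, e ∉ F ∧ ∀ x ∈ K, ∃ n : ℕ, x = n • e := by
  obtain ⟨K, hK, hsum, huniq⟩ := h
  have h0 : ∀ x ∈ F, x ∈ K → x = 0 := fun x hxF hxK =>
    (huniq x hxF 0 hK.2.1 0 hF.2.1 x hxK (by rw [add_zero, zero_add])).1
  have hKF : ¬ K ⊆ F := by
    intro hKF
    have : F = M := hF.1.antisymm fun m hm => by
      obtain ⟨a, ha, b, hb, rfl⟩ := hsum m hm
      exact hF.add_mem ha (hKF hb)
    rw [this] at hr
    exact absurd hr (Nat.ne_of_lt (Nat.lt_succ_self _))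
  obtain ⟨x, hx, hxF⟩ := Set.not_subset.1 hKF
  have hKr : setRank K ≤ 1 := by
    rw [← Nat.zero_add 1, ← setRank_singleton_zero (Λ := Λ)]
    refine setRank_le_add_one (x := x) fun y hy => ?_
    obtain ⟨b, hb, a, g, hg, z, hz, e⟩ :=
      hF.exists_nsmul_add_eq hM (IsFace.self M) hF.1 (hK.1 hx) hxF
      (fun G hG hFG hGM hxG => by
        refine (hF.eq_of_setRank_le hGM hFG ?_).symm
        have := hG.setRank_lt (G := M) subset_rfl hGM (fun h => hxG (h ▸ hK.1 hx))
        change _ < monRank M at this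
        omega) (hK.1 hy)
    refine ⟨b, hb, a, 0, rfl, 0, rfl, ?_⟩
    rw [add_zero, add_zero]
    exact (huniq g hg _ (hK.nsmul_mem hy b) z hz _ (hK.nsmul_mem hx a)
      (by rw [add_comm g, e, add_comm])).2
  obtain ⟨e, he, hgen⟩ := hK.exists_generator hsharp hsat hKr
  refine ⟨K, hK, hKr, h0, hsum, e, he, fun heF => hxF ?_, hgen⟩
  obtain ⟨n, rfl⟩ := hgen x hx
  exact hF.nsmul_mem heF n

lemma principal_of_splitsOff (hM : M.FG) (hsharp : IsSharp M)
    (hsat : ∀ (x : Λ) (n : ℕ), 0 < n → n • x ∈ M → x ∈ M) (hF : IsFace M F)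
    (hr : monRank M = setRank F + 1) (h : SplitsOff M F) :
    ∃ e ∈ M, (M : Set Λ) \ F = {x : Λ | ∃ m ∈ M, x = e + m} := by
  obtain ⟨K, hK, -, -, hsum, e, he, heF, hgen⟩ :=
    hF.exists_generator_of_splitsOff hM hsharp hsat hr h
  refine ⟨e, hK.1 he, Set.Subset.antisymm ?_ ?_⟩
  · rintro x ⟨hx, hxF⟩
    obtain ⟨a, ha, b, hb, rfl⟩ := hsum x hx
    obtain ⟨n, rfl⟩ := hgen b hb
    rcases n with _ | n
    · exact absurd (by simpa using ha) hxF
    · exact ⟨a + n • e, M.add_mem (hF.1 ha) (AddSubmonoid.nsmul_mem M (hK.1 he) n),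
        by rw [succ_nsmul]; abel⟩
  · rintro _ ⟨m, hm, rfl⟩
    exact ⟨M.add_mem (hK.1 he) hm, fun h => heF (hF.of_add (hK.1 he) hm h).1⟩

lemma isPrimeMonIdeal_and_height_of_splitsOff (hM : M.FG) (hsharp : IsSharp M)
    (hsat : ∀ (x : Λ) (n : ℕ), 0 < n → n • x ∈ M → x ∈ M) (hF : IsFace M F)
    (hr : monRank M = setRank F + 1) (h : SplitsOff M F) :
    IsPrimeMonIdeal M ((F \ {0}) + (M : Set Λ)) ∧
      (monRank M : ℕ∞) ≤ primeHeight M ((F \ {0}) + (M : Set Λ)) + 1 := by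
  obtain ⟨K, hK, hKr, h0, hsum, -⟩ := hF.exists_generator_of_splitsOff hM hsharp hsat hr h
  have hI : (F \ {0}) + (M : Set Λ) = (M : Set Λ) \ K := by
    ext x
    rw [mem_posPart_add]
    constructor
    · rintro ⟨f, hf, hf0, m, hm, rfl⟩
      exact ⟨M.add_mem (hF.1 hf) hm, fun h => hf0 (h0 f hf (hK.of_add (hF.1 hf) hm h).1)⟩
    · rintro ⟨hx, hxK⟩
      obtain ⟨a, ha, b, hb, rfl⟩ := hsum x hx
      exact ⟨a, ha, fun ha0 => hxK (by rwa [ha0, zero_add]), b, hK.1 hb, rfl⟩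
  rw [hI, ← hK.primeHeight_add_setRank hM]
  refine ⟨hK.isPrimeMonIdeal, ?_⟩
  gcongr
  exact_mod_cast hKr

lemma edges_of_height (hM : M.FG) (hsharp : IsSharp M) (hF : IsFace M F)
    (hI : IsPrimeMonIdeal M ((F \ {0}) + (M : Set Λ)))
    (hh : (monRank M : ℕ∞) ≤ primeHeight M ((F \ {0}) + (M : Set Λ)) + 1)
    (E E' : Set Λ) (hE : IsEdge M E) (hEF : ¬ E ⊆ F) (hE' : IsEdge M E') (hEF' : ¬ E' ⊆ F) :
    E = E' := by
  have hK := hI.isFace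
  have h := hK.primeHeight_add_setRank hM
  rw [Set.sdiff_sdiff_cancel_left hI.1.1] at h
  have hKr : setRank ((M : Set Λ) \ ((F \ {0}) + (M : Set Λ))) ≤ 1 := by
    rw [← h] at hh
    have hfin : primeHeight M ((F \ {0}) + (M : Set Λ)) ≠ ⊤ := by
      intro htop
      rw [htop, top_add] at h
      exact ENat.natCast_ne_top _ h.symm
    exact_mod_cast (ENat.add_le_add_iff_left hfin).1 hh
  have key : ∀ E, IsEdge M E → ¬ E ⊆ F → E = (M : Set Λ) \ ((F \ {0}) + (M : Set Λ)) :=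
    fun E hE hEF => hE.1.eq_of_setRank_le hK.1 (hF.edge_subset_compl hsharp hE hEF) (hE.2 ▸ hKr)
  rw [key E hE hEF, key E' hE' hEF']

lemma eq_sUnion_of_splitsOff (hM : M.FG) (hsharp : IsSharp M)
    (hsat : ∀ (x : Λ) (n : ℕ), 0 < n → n • x ∈ M → x ∈ M) (hF : IsFace M F)
    (hr : monRank M = setRank F + 1) (h : SplitsOff M F) :
    (F \ {0}) + (M : Set Λ) =
      ⋃₀ {q : Set Λ | IsPrimeMonIdeal M q ∧ primeHeight M q = 1 ∧ q ≠ (M : Set Λ) \ F} := by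
  obtain ⟨K, hK, -, -, hsum, e, he, heF, hgen⟩ :=
    hF.exists_generator_of_splitsOff hM hsharp hsat hr h
  ext x
  constructor
  · intro hx
    obtain ⟨f, hf, hf0, m, hm, rfl⟩ := mem_posPart_add.1 hx
    obtain ⟨G, hG, -, -, hfG, hGr⟩ := (IsFace.zero hsharp).exists_facet_not_mem hM
      (IsFace.self M) (by simp) (hF.1 hf) hf0
    refine ⟨(M : Set Λ) \ G, ⟨hG.isPrimeMonIdeal, (hG.primeHeight_eq_one_iff hM).2 hGr, ?_⟩,
      hG.isPrimeMonIdeal.1.2 f ⟨hF.1 hf, hfG⟩ m hm⟩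
    intro h
    exact (h ▸ ⟨hF.1 hf, hfG⟩ : f ∈ (M : Set Λ) \ F).2 hf
  · rintro ⟨q, ⟨hq, hq1, hqF⟩, hxq⟩
    obtain ⟨a, ha, b, hb, rfl⟩ := hsum x (hq.1.1 hxq)
    refine mem_posPart_add.2 ⟨a, ha, ?_, b, hK.1 hb, rfl⟩
    rintro rfl
    obtain ⟨n, rfl⟩ := hgen b hb
    have hG := hq.isFace
    have hGq := Set.sdiff_sdiff_cancel_left hq.1.1
    have heG : e ∉ (M : Set Λ) \ q := by
      intro heG
      rw [zero_add] at hxq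
      exact (hG.nsmul_mem heG n).2 hxq
    have hGF : (M : Set Λ) \ q ⊆ F := by
      intro y hy
      obtain ⟨a, ha, b, hb, rfl⟩ := hsum y hy.1
      obtain ⟨n, rfl⟩ := hgen b hb
      rcases Nat.eq_zero_or_pos n with rfl | hn
      · simpa using ha
      · exact absurd (hG.of_nsmul_mem (hK.1 he) hn (hG.of_add (hF.1 ha) (hK.1 hb) hy).2) heG
    rw [← hGq, hG.primeHeight_eq_one_iff hM] at hq1
    refine hqF ?_
    rw [← hG.eq_of_setRank_le hF.1 hGF (by omega), hGq]

lemma edges_of_eq_sUnion (hM : M.FG) (hsharp : IsSharp M) (hF : IsFace M F)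
    (h : (F \ {0}) + (M : Set Λ) =
      ⋃₀ {q : Set Λ | IsPrimeMonIdeal M q ∧ primeHeight M q = 1 ∧ q ≠ (M : Set Λ) \ F}) :
    IsPrimeMonIdeal M ((F \ {0}) + (M : Set Λ)) ∧
      ∀ E E' : Set Λ, IsEdge M E → ¬ E ⊆ F → IsEdge M E' → ¬ E' ⊆ F → E = E' := by
  constructor
  · refine ⟨⟨?_, ?_⟩, ?_, ?_⟩
    · intro x hx
      obtain ⟨f, hf, -, m, hm, rfl⟩ := mem_posPart_add.1 hx
      exact M.add_mem (hF.1 hf) hm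
    · intro x hx m' hm'
      obtain ⟨f, hf, hf0, m, hm, rfl⟩ := mem_posPart_add.1 hx
      exact mem_posPart_add.2 ⟨f, hf, hf0, m + m', M.add_mem hm hm', (add_assoc _ _ _).symm⟩
    · intro hIM
      have h0 : (0 : Λ) ∈ (F \ {0}) + (M : Set Λ) := by
        rw [hIM]
        exact M.zero_mem
      obtain ⟨f, hf, hf0, m, hm, e⟩ := mem_posPart_add.1 h0
      exact hf0 (hsharp f (hF.1 hf) m hm e)
    · rw [h]
      rintro x hx y hy ⟨q, hq, hxy⟩
      exact (hq.1.2.2 x hx y hy hxy).imp (fun h => ⟨q, hq, h⟩) fun h => ⟨q, hq, h⟩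
  · have key : ∀ E, IsEdge M E → ¬ E ⊆ F → E = (M : Set Λ) \ ((F \ {0}) + (M : Set Λ)) := by
      intro E hE hEF
      refine (hF.edge_subset_compl hsharp hE hEF).antisymm fun y hy => ?_
      by_contra hyE
      obtain ⟨G, hG, hEG, -, hyG, hGr⟩ :=
        hE.1.exists_facet_not_mem hM (IsFace.self M) hE.1.1 hy.1 hyE
      refine hy.2 (h ▸ ⟨(M : Set Λ) \ G, ⟨hG.isPrimeMonIdeal,
        (hG.primeHeight_eq_one_iff hM).2 hGr, fun e => hEF ?_⟩, hy.1, hyG⟩)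
      rwa [← Set.sdiff_sdiff_cancel_left hF.1, ← e, Set.sdiff_sdiff_cancel_left hG.1]
    intro E E' hE hEF hE' hEF'
    rw [key E hE hEF, key E' hE' hEF']

end IsFace

/-- Lemma `splitfacet`. Let `M` be a sharp toric monoid, `p ⊂ M` a prime
ideal of height `1` and `F = M ∖ p` its facet. The following are equivalent:
(a) `F` splits off; (b) `(F⁺) = F⁺ + M` is prime and `height((F⁺)) ≥ rk(M) − 1`;
(c) `(F⁺)` is prime and at most one edge of `M` is not contained in `F`;
(d) `(F⁺)` is the union of all prime ideals of height `1` different from `p`;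
(e) `p` is principal. -/
theorem statement1 (M : AddSubmonoid Λ) (hM : IsToric M) (hsharp : IsSharp M)
    (p : Set Λ) (hp : IsPrimeMonIdeal M p) (hht : primeHeight M p = 1) :
    [SplitsOff M ((M : Set Λ) \ p),
     IsPrimeMonIdeal M ((((M : Set Λ) \ p) \ {0}) + (M : Set Λ)) ∧
       (monRank M : ℕ∞) ≤ primeHeight M ((((M : Set Λ) \ p) \ {0}) + (M : Set Λ)) + 1,
     IsPrimeMonIdeal M ((((M : Set Λ) \ p) \ {0}) + (M : Set Λ)) ∧
       ∀ E E' : Set Λ, IsEdge M E → ¬ E ⊆ (M : Set Λ) \ p →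
         IsEdge M E' → ¬ E' ⊆ (M : Set Λ) \ p → E = E',
     (((M : Set Λ) \ p) \ {0}) + (M : Set Λ) =
       ⋃₀ {q : Set Λ | IsPrimeMonIdeal M q ∧ primeHeight M q = 1 ∧ q ≠ p},
     ∃ e ∈ M, p = {x : Λ | ∃ m ∈ M, x = e + m}].TFAE := by
  obtain ⟨hfg, hgen, htf, hsat⟩ := hM
  have : Module.Finite ℤ Λ := by
    rw [Module.Finite.iff_addGroup_fg]
    obtain ⟨S, hS⟩ := hfg
    refine ⟨S, ?_⟩
    rw [eq_top_iff, ← hgen, ← hS, AddSubgroup.closure_le]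
    exact AddSubgroup.le_closure_toAddSubmonoid _
  have : IsAddTorsionFree Λ := ⟨fun n hn x y h => sub_eq_zero.1
    (htf _ n (Nat.pos_of_ne_zero hn) (by rw [nsmul_sub]; exact sub_eq_zero.2 h))⟩
  have : Module.Free ℤ Λ := inferInstance
  obtain ⟨F, hF, rfl⟩ : ∃ F, IsFace M F ∧ p = (M : Set Λ) \ F :=
    ⟨_, hp.isFace, (Set.sdiff_sdiff_cancel_left hp.1.1).symm⟩
  have hr := (hF.primeHeight_eq_one_iff hfg).1 hht
  simp only [Set.sdiff_sdiff_cancel_left hF.1]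
  tfae_have 1 → 2 := hF.isPrimeMonIdeal_and_height_of_splitsOff hfg hsharp hsat hr
  tfae_have 2 → 3 := fun h => ⟨h.1, hF.edges_of_height hfg hsharp h.1 h.2⟩
  tfae_have 3 → 1 := fun h => hF.splitsOff_of_edges hfg hsharp hsat h.1 h.2
  tfae_have 1 → 4 := hF.eq_sUnion_of_splitsOff hfg hsharp hsat hr
  tfae_have 4 → 3 := hF.edges_of_eq_sUnion hfg hsharp
  tfae_have 1 → 5 := hF.principal_of_splitsOff hfg hsharp hsat hr
  tfae_have 5 → 1 := fun ⟨_, he, h⟩ => hF.splitsOff_of_principal hfg hsharp he h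
  tfae_finish
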